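/- Let q = 2^n with q > 4 and let r ∈ F_{q^2} with r ∉ F_q. Define f: F_q → F_{q^2} by f(x) = x + 1/(x − r) + 1/(x − r^q). Then the sum over all x ∈ F_q of f(x)^3 equals (1 + r + r^q)^2 / (r + r^q). -/

import Mathlib

open Finset Polynomial in
theorem FiniteField.mem_range_algebraMap_of_pow_card_eq {F K : Type*} [Field F] [Fintype F]
    [Field K] [Algebra F K] {y : K} (hy : y ^ Fintype.card F = y) :
    y ∈ Set.range (algebraMap F K) := by
  classical
  have hp := FiniteField.X_pow_card_sub_X_ne_zero K (Fintype.one_lt_card (α := F))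
  have hsub : univ.image (algebraMap F K) ⊆ (X ^ Fintype.card F - X : K[X]).roots.toFinset := by
    intro z hz
    obtain ⟨x, -, rfl⟩ := mem_image.mp hz
    simp [mem_roots hp, ← map_pow, FiniteField.pow_card]
  have hcard : (X ^ Fintype.card F - X : K[X]).roots.toFinset.card
      ≤ (univ.image (algebraMap F K)).card := by
    rw [card_image_of_injective _ (algebraMap F K).injective, card_univ]
    refine (Multiset.toFinset_card_le _).trans ((card_roots' _).trans ?_)
    rw [FiniteField.X_pow_card_sub_X_natDegree_eq K Fintype.one_lt_card]
  have hmem : y ∈ (X ^ Fintype.card F - X : K[X]).roots.toFinset := by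
    simp [mem_roots hp, hy]
  rw [← eq_of_subset_of_card_le hsub hcard] at hmem
  simpa using hmem

theorem FiniteField.sum_pow_card_sub_one (F : Type*) [Field F] [Fintype F] :
    ∑ x : F, x ^ (Fintype.card F - 1) = -1 := by
  classical
  have hq := Fintype.one_lt_card (α := F)
  have h : ∀ x : F, x ^ (Fintype.card F - 1) = 1 - if x = 0 then 1 else 0 := by
    intro x
    split_ifs with hx
    · rw [hx, zero_pow (by omega), sub_self]
    · rw [FiniteField.pow_card_sub_one_eq_one x hx, sub_zero]
  simp [h]

theorem FiniteField.sum_algebraMap_add_pow_card_sub_one {F K : Type*} [Field F] [Fintype F]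
    [Field K] [Algebra F K] (r : K) :
    ∑ x : F, (algebraMap F K x + r) ^ (Fintype.card F - 1) = -1 := by
  simp_rw [add_pow]
  rw [Finset.sum_comm, Finset.sum_range_succ, Finset.sum_eq_zero, zero_add]
  · simp [← map_pow, ← map_sum, FiniteField.sum_pow_card_sub_one]
  · intro m hm
    simp_rw [← Finset.sum_mul, ← map_pow, ← map_sum]
    simp [FiniteField.sum_pow_lt_card_sub_one F m (Finset.mem_range.mp hm)]


/-- For `q = 2^n`, `q > 4`, `r ∈ F_{q²} \ F_q`, and `f(x) = x + 1/(x - r) + 1/(x - r^q)`,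
`∑_{x ∈ F_q} f(x)³ = (1 + r + r^q)² / (r + r^q)`. -/
theorem stmt_11 (n : ℕ) (q : ℕ) (hq : q = 2 ^ n) (hq4 : 4 < q)
    (F K : Type*) [Field F] [Fintype F] [Field K] [Fintype K] [Algebra F K]
    (hF : Fintype.card F = q) (hK : Fintype.card K = q ^ 2)
    (r : K) (hr : r ∉ Set.range (algebraMap F K)) :
    ∑ x : F, (algebraMap F K x + (algebraMap F K x - r)⁻¹
        + (algebraMap F K x - r ^ q)⁻¹) ^ 3
      = (1 + r + r ^ q) ^ 2 / (r + r ^ q) := by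
  subst hF
  have h2 : (2 : K) = 0 := by
    have h := FiniteField.cast_card_eq_zero K
    rw [hK, hq] at h
    push_cast at h
    exact eq_zero_of_pow_eq_zero (eq_zero_of_pow_eq_zero h)
  have : CharP K 2 := CharTwo.of_one_ne_zero_of_two_eq_zero one_ne_zero h2
  obtain ⟨s, hs⟩ : ∃ s, s = r ^ Fintype.card F := ⟨_, rfl⟩
  have hsr : s ^ Fintype.card F = r := by
    rw [hs, ← pow_mul, ← sq, ← hK, FiniteField.pow_card]
  have hadd (y z : K) : (y + z) ^ Fintype.card F = y ^ Fintype.card F + z ^ Fintype.card F := by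
    rw [hq, add_pow_char_pow]
  have ht : r + s ≠ 0 := by
    intro h
    refine hr (FiniteField.mem_range_algebraMap_of_pow_card_eq ?_)
    rw [← hs]
    linear_combination h - r * h2
  obtain ⟨c, hc⟩ : r + s ∈ Set.range (algebraMap F K) :=
    FiniteField.mem_range_algebraMap_of_pow_card_eq (by rw [hadd, hsr, ← hs, add_comm])
  rw [← hs]
  have hxr (x : F) : algebraMap F K x + r ≠ 0 := fun h =>
    hr ⟨x, by linear_combination h - r * h2⟩
  have hshift (x : F) : algebraMap F K (x + c) + r = algebraMap F K x + s := by
    rw [map_add, hc]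
    linear_combination r * h2
  have hxs (x : F) : algebraMap F K x + s ≠ 0 := hshift x ▸ hxr (x + c)
  have hsum (k : ℕ) : ∑ x : F, (algebraMap F K x + s)⁻¹ ^ k
      = ∑ x : F, (algebraMap F K x + r)⁻¹ ^ k := by
    simp_rw [← hshift]
    exact Equiv.sum_comp (Equiv.addRight c) fun x => (algebraMap F K x + r)⁻¹ ^ k
  have hcard : (Fintype.card F : K) = 0 := by
    rw [← map_natCast (algebraMap F K), FiniteField.cast_card_eq_zero, map_zero]
  have hone : ∑ x : F, (algebraMap F K x + r)⁻¹ = (r + s)⁻¹ := by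
    have h (x : F) : (algebraMap F K x + r)⁻¹
        = (r + s)⁻¹ * ((algebraMap F K x + r) ^ (Fintype.card F - 1) + 1) := by
      have hpow : (algebraMap F K x + r) ^ (Fintype.card F - 1) * (algebraMap F K x + r)
          = algebraMap F K x + s := by
        rw [pow_sub_one_mul (by omega), hadd, ← map_pow, FiniteField.pow_card, ← hs]
      have := hxr x
      field_simp
      linear_combination -hpow - algebraMap F K x * h2
    simp_rw [h, ← Finset.mul_sum, Finset.sum_add_distrib,
      FiniteField.sum_algebraMap_add_pow_card_sub_one]
    simp [hcard, CharTwo.neg_eq]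
  have htwo : ∑ x : F, (algebraMap F K x + r)⁻¹ ^ 2 = (r + s)⁻¹ ^ 2 := by
    rw [← hone, CharTwo.sum_sq]
  have hcube : ∑ x : F, algebraMap F K x ^ 3 = 0 := by
    simp_rw [← map_pow, ← map_sum]
    rw [FiniteField.sum_pow_lt_card_sub_one F 3 (by omega), map_zero]
  have hsum_one : ∑ x : F, (algebraMap F K x + s)⁻¹ = (r + s)⁻¹ := by
    simpa [hone] using hsum 1
  have hexpand (x : F) : (algebraMap F K x + (algebraMap F K x - r)⁻¹
        + (algebraMap F K x - s)⁻¹) ^ 3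
      = algebraMap F K x ^ 3 + (r + s)
        + (r ^ 2 + 1) * (algebraMap F K x + r)⁻¹ + (s ^ 2 + 1) * (algebraMap F K x + s)⁻¹
        + (r + (r + s)⁻¹) * (algebraMap F K x + r)⁻¹ ^ 2
        + (s + (r + s)⁻¹) * (algebraMap F K x + s)⁻¹ ^ 2
        + (algebraMap F K x + r)⁻¹ ^ 3 + (algebraMap F K x + s)⁻¹ ^ 3 := by
    have ha := mul_inv_cancel₀ (hxr x)
    have hb := mul_inv_cancel₀ (hxs x)
    have hu := mul_inv_cancel₀ ht
    simp only [CharTwo.sub_eq_add]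
    generalize (algebraMap F K x + r)⁻¹ = a at *
    generalize (algebraMap F K x + s)⁻¹ = b at *
    generalize (r + s)⁻¹ = u at *
    generalize algebraMap F K x = y at *
    have hab : a * b = u * (a + b) := by
      grind
    grind
  simp_rw [hexpand, Finset.sum_add_distrib, ← Finset.mul_sum, hsum, hcube, hone, hsum_one, htwo]
  simp only [Finset.sum_const, Finset.card_univ, nsmul_eq_mul, hcard]
  field_simp
  grind
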